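/- Let A be a C*-algebra, X a compact Hausdorff space, x_0 a point of X, and P a proper ideal of A. Then I_{x_0,P} := {f ∈ C(X,A) : f(x_0) ∈ P} is a minimal primal ideal of C(X,A) if and only if P is a minimal primal ideal of A. -/

import Mathlib

noncomputable section

/-- The product `a 0 * a 1 * ⋯ * a n` of a nonempty tuple (grouped to the left). -/
def finProd {R : Type*} [Mul R] : (n : ℕ) → (Fin (n + 1) → R) → R
  | 0, a => a 0
  | n + 1, a => finProd n (fun i => a i.castSucc) * a (Fin.last (n + 1))

section Ideals

variable {R : Type*} [NonUnitalRing R] [TopologicalSpace R]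

/-- `I` is a norm-closed two-sided ideal of `R`. -/
structure IsClosedIdealR (I : Set R) : Prop where
  isClosed : IsClosed I
  zero_mem : (0 : R) ∈ I
  add_mem : ∀ a b, a ∈ I → b ∈ I → a + b ∈ I
  neg_mem : ∀ a, a ∈ I → -a ∈ I
  mul_mem_left : ∀ a b, b ∈ I → a * b ∈ I
  mul_mem_right : ∀ a b, a ∈ I → a * b ∈ I

/-- `P` is a primal ideal of `R`: for every `n ≥ 1` and all closed two-sided ideals
`J 0, …, J (n-1)` of `R` such that `a 0 * ⋯ * a (n-1) = 0` for all choices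
`a i ∈ J i`, some `J k` is contained in `P`. -/
def IsPrimalR (P : Set R) : Prop :=
  IsClosedIdealR P ∧
    ∀ (n : ℕ) (J : Fin (n + 1) → Set R), (∀ i, IsClosedIdealR (J i)) →
      (∀ a : Fin (n + 1) → R, (∀ i, a i ∈ J i) → finProd n a = 0) →
      ∃ k, J k ⊆ P

end Ideals

/-- `P` is a minimal primal ideal of `R`: `P` is primal and contains no strictly
smaller primal ideal. -/
def IsMinPrimalR {R : Type*} [NonUnitalRing R] [TopologicalSpace R] (P : Set R) : Prop :=
  IsPrimalR P ∧ ∀ Q : Set R, IsPrimalR Q → Q ⊆ P → Q = P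

theorem finProd_apply_aux {A : Type*} [NonUnitalCStarAlgebra A] {X : Type*} [TopologicalSpace X]
    (x : X) : ∀ (n : ℕ) (f : Fin (n + 1) → C(X, A)),
      (finProd n f) x = finProd n (fun i => f i x)
  | 0, f => rfl
  | n + 1, f => by
    simp only [finProd, ContinuousMap.mul_apply]
    rw [finProd_apply_aux x n]

theorem finProd_cont_aux {A : Type*} [NonUnitalCStarAlgebra A] :
    ∀ (n : ℕ), Continuous (fun a : Fin (n + 1) → A => finProd n a)
  | 0 => by simp only [finProd]; fun_prop
  | n + 1 => by
    simp only [finProd]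
    exact ((finProd_cont_aux n).comp (by fun_prop)).mul (by fun_prop)

theorem closed_eval_aux {A : Type*} [NonUnitalCStarAlgebra A] {X : Type*} [TopologicalSpace X]
    [CompactSpace X] (x₀ : X) (P : Set A) (hP : IsClosedIdealR P) :
    IsClosedIdealR {f : C(X, A) | f x₀ ∈ P} where
  isClosed := hP.isClosed.preimage (continuous_eval_const (F := C(X, A)) x₀)
  zero_mem := hP.zero_mem
  add_mem _ _ ha hb := hP.add_mem _ _ ha hb
  neg_mem _ ha := hP.neg_mem _ ha
  mul_mem_left _ _ hb := hP.mul_mem_left _ _ hb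
  mul_mem_right _ _ ha := hP.mul_mem_right _ _ ha

theorem closed_forall_aux {A : Type*} [NonUnitalCStarAlgebra A] {X : Type*} [TopologicalSpace X]
    [CompactSpace X] (S : Set X) (P : Set A) (hP : IsClosedIdealR P) :
    IsClosedIdealR {f : C(X, A) | ∀ x ∈ S, f x ∈ P} where
  isClosed := by
    simp only [Set.ofPred_forall]
    exact isClosed_iInter fun x => isClosed_iInter fun _ => (closed_eval_aux x P hP).isClosed
  zero_mem _ _ := hP.zero_mem
  add_mem _ _ ha hb x hx := hP.add_mem _ _ (ha x hx) (hb x hx)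
  neg_mem _ ha x hx := hP.neg_mem _ (ha x hx)
  mul_mem_left _ _ hb x hx := hP.mul_mem_left _ _ (hb x hx)
  mul_mem_right _ _ ha x hx := hP.mul_mem_right _ _ (ha x hx)

theorem zero_closed_aux {A : Type*} [NonUnitalCStarAlgebra A] : IsClosedIdealR ({0} : Set A) where
  isClosed := isClosed_singleton
  zero_mem := rfl
  add_mem a b ha hb := by simp_all
  neg_mem a ha := by simp_all
  mul_mem_left a b hb := by simp_all
  mul_mem_right a b ha := by simp_all

theorem closed_const_aux {A : Type*} [NonUnitalCStarAlgebra A] {X : Type*} [TopologicalSpace X]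
    [CompactSpace X] (Q : Set C(X, A)) (hQ : IsClosedIdealR Q) :
    IsClosedIdealR {a : A | ContinuousMap.const X a ∈ Q} where
  isClosed := hQ.isClosed.preimage ContinuousMap.continuous_const'
  zero_mem := hQ.zero_mem
  add_mem _ _ ha hb := hQ.add_mem _ _ ha hb
  neg_mem _ ha := hQ.neg_mem _ ha
  mul_mem_left a b hb := hQ.mul_mem_left (ContinuousMap.const X a) (ContinuousMap.const X b) hb
  mul_mem_right a b ha := hQ.mul_mem_right (ContinuousMap.const X a) (ContinuousMap.const X b) ha

theorem closure_eval_aux {A : Type*} [NonUnitalCStarAlgebra A] {X : Type*} [TopologicalSpace X]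
    [CompactSpace X] (x₀ : X) (J : Set C(X, A)) (hJ : IsClosedIdealR J) :
    IsClosedIdealR (closure ((fun f : C(X, A) => f x₀) '' J)) where
  isClosed := isClosed_closure
  zero_mem := subset_closure ⟨0, hJ.zero_mem, rfl⟩
  add_mem a b ha hb := by
    refine map_mem_closure₂ continuous_add ha hb ?_
    rintro _ ⟨f, hf, rfl⟩ _ ⟨g, hg, rfl⟩
    exact ⟨f + g, hJ.add_mem _ _ hf hg, rfl⟩
  neg_mem a ha := by
    refine map_mem_closure continuous_neg ha ?_
    rintro _ ⟨f, hf, rfl⟩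
    exact ⟨-f, hJ.neg_mem _ hf, rfl⟩
  mul_mem_left a b hb := by
    refine map_mem_closure (continuous_const_mul a) hb ?_
    rintro _ ⟨f, hf, rfl⟩
    exact ⟨ContinuousMap.const X a * f, hJ.mul_mem_left _ _ hf, rfl⟩
  mul_mem_right a b ha := by
    refine map_mem_closure (f := fun z => z * b) (continuous_mul_const b) ha ?_
    rintro _ ⟨f, hf, rfl⟩
    exact ⟨f * ContinuousMap.const X b, hJ.mul_mem_right _ _ hf, rfl⟩

theorem primal_eval_aux {A : Type*} [NonUnitalCStarAlgebra A] {X : Type*} [TopologicalSpace X]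
    [CompactSpace X] (x₀ : X) (P : Set A) (hP : IsPrimalR P) :
    IsPrimalR {f : C(X, A) | f x₀ ∈ P} := by
  refine ⟨closed_eval_aux x₀ P hP.1, fun n J hJ h0 => ?_⟩
  obtain ⟨k, hk⟩ := hP.2 n (fun i => closure ((fun f : C(X, A) => f x₀) '' J i))
    (fun i => closure_eval_aux x₀ _ (hJ i)) (by
      intro a ha
      have hmem : a ∈ closure (Set.univ.pi fun i => (fun f : C(X, A) => f x₀) '' J i) := by
        rw [closure_pi_set]
        exact fun i _ => ha i
      have hcl : IsClosed {a : Fin (n + 1) → A | finProd n a = 0} :=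
        isClosed_eq (finProd_cont_aux n) continuous_const
      refine closure_minimal ?_ hcl hmem
      intro b hb
      choose f hf hfb using fun i => hb i (Set.mem_univ i)
      have h1 := finProd_apply_aux x₀ n f
      rw [h0 f hf] at h1
      have : b = fun i => f i x₀ := funext fun i => (hfb i).symm
      rw [Set.mem_ofPred_eq, this, ← h1]
      rfl)
  exact ⟨k, fun f hf => hk (subset_closure ⟨f, hf, rfl⟩)⟩

theorem primal_of_eval_aux {A : Type*} [NonUnitalCStarAlgebra A] {X : Type*} [TopologicalSpace X]
    [CompactSpace X] (x₀ : X) (P : Set A) (hP : IsClosedIdealR P)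
    (h : IsPrimalR {f : C(X, A) | f x₀ ∈ P}) : IsPrimalR P := by
  refine ⟨hP, fun n J hJ h0 => ?_⟩
  obtain ⟨k, hk⟩ := h.2 n (fun i => {f : C(X, A) | ∀ x ∈ Set.univ, f x ∈ J i})
    (fun i => closed_forall_aux _ _ (hJ i)) (by
      intro f hf
      ext x
      rw [finProd_apply_aux]
      exact h0 _ fun i => hf i x (Set.mem_univ x))
  exact ⟨k, fun a ha => hk (a := ContinuousMap.const X a) (fun x _ => ha)⟩

theorem vanish_mem_aux {A : Type*} [NonUnitalCStarAlgebra A] {X : Type*} [TopologicalSpace X]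
    [CompactSpace X] (x₀ : X) (P : Set A) (hPproper : P ≠ Set.univ)
    (Q : Set C(X, A)) (hQ : IsPrimalR Q) (hQP : Q ⊆ {f : C(X, A) | f x₀ ∈ P})
    (hP : IsClosedIdealR P) (f : C(X, A)) (hf : f x₀ = 0) : f ∈ Q := by
  rw [← hQ.1.isClosed.closure_eq, Metric.mem_closure_iff]
  intro ε hε
  obtain ⟨a, ha⟩ := (Set.ne_univ_iff_exists_notMem P).1 hPproper
  set δ := ε / 2 with hδ
  have hδ0 : 0 < δ := by positivity
  let V : Set X := {x | ‖f x‖ < δ}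
  have hmax : ∀ x, max ‖f x‖ δ ≠ 0 := fun x => (lt_max_of_lt_right hδ0).ne'
  let g : C(X, A) := ⟨fun x => (1 - δ / max ‖f x‖ δ) • f x, by
    have hc : Continuous fun x => (1 - δ / max ‖f x‖ δ) :=
      continuous_const.sub (continuous_const.div (by fun_prop) hmax)
    fun_prop⟩
  obtain ⟨k, hk⟩ := hQ.2 1 ![{f : C(X, A) | ∀ x ∈ V, f x ∈ ({0} : Set A)},
      {f : C(X, A) | ∀ x ∈ Vᶜ, f x ∈ ({0} : Set A)}] (by
        intro i
        fin_cases i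
        · exact closed_forall_aux V _ zero_closed_aux
        · exact closed_forall_aux Vᶜ _ zero_closed_aux) (by
        intro u hu
        have h0 := hu 0
        have h1 := hu 1
        ext x
        rw [finProd_apply_aux]
        change u 0 x * u 1 x = 0
        by_cases hx : x ∈ V
        · rw [show u 0 x = 0 from h0 x hx, zero_mul]
        · rw [show u 1 x = 0 from h1 x hx, mul_zero])
  fin_cases k
  · refine ⟨g, hk ?_, ?_⟩
    · intro x hx
      have hx' : ‖f x‖ < δ := hx
      change (1 - δ / max ‖f x‖ δ) • f x = 0
      rw [max_eq_right hx'.le, div_self hδ0.ne', sub_self, zero_smul]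
    · rw [dist_eq_norm]
      refine lt_of_le_of_lt ((ContinuousMap.norm_le _ hδ0.le).2 fun x => ?_)
        (show δ < ε by rw [hδ]; linarith)
      have : (f - g) x = (δ / max ‖f x‖ δ) • f x := by
        change f x - (1 - δ / max ‖f x‖ δ) • f x = _
        rw [sub_smul, one_smul, sub_sub_cancel]
      have hpos : 0 < max ‖f x‖ δ := lt_max_of_lt_right hδ0
      rw [this, norm_smul, Real.norm_of_nonneg (by positivity), div_mul_eq_mul_div,
        div_le_iff₀ hpos]
      exact mul_le_mul_of_nonneg_left (le_max_left _ _) hδ0.le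
  · exfalso
    let w : C(X, A) := ⟨fun x => (max 0 (1 - ‖f x‖ / δ)) • a, by fun_prop⟩
    have hw : w ∈ Q := hk (by
      intro x hx
      have hx' : δ ≤ ‖f x‖ := not_lt.1 hx
      change (max 0 (1 - ‖f x‖ / δ)) • a = 0
      rw [max_eq_left, zero_smul]
      rw [sub_nonpos, le_div_iff₀ hδ0, one_mul]
      exact hx')
    have h2 : w x₀ ∈ P := hQP hw
    have h3 : w x₀ = a := by
      change (max 0 (1 - ‖f x₀‖ / δ)) • a = a
      simp [hf]
    exact ha (h3 ▸ h2)

/-- If `A` is a C*-algebra, `X` a compact Hausdorff space, `x₀ ∈ X`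
and `P` a proper ideal of `A`, then `I_{x₀,P} = {f ∈ C(X,A) : f x₀ ∈ P}` is a minimal
primal ideal of `C(X,A)` if and only if `P` is a minimal primal ideal of `A`. -/
theorem minPrimal_eval_ideal_iff_minPrimal_cstar
    {A : Type*} [NonUnitalCStarAlgebra A]
    {X : Type*} [TopologicalSpace X] [CompactSpace X] [T2Space X] (x₀ : X)
    (P : Set A) (hP : IsClosedIdealR P) (hPproper : P ≠ Set.univ) :
    IsMinPrimalR {f : C(X, A) | f x₀ ∈ P} ↔ IsMinPrimalR P := by
  constructor
  · rintro ⟨h1, h2⟩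
    refine ⟨primal_of_eval_aux x₀ P hP h1, fun Q hQ hQP => ?_⟩
    have h3 := h2 _ (primal_eval_aux x₀ Q hQ) (fun f hf => hQP hf)
    refine hQP.antisymm fun a ha => ?_
    have h4 : ContinuousMap.const X a ∈ {f : C(X, A) | f x₀ ∈ P} := ha
    rw [← h3] at h4
    exact h4
  · rintro ⟨h1, h2⟩
    refine ⟨primal_eval_aux x₀ P h1, fun Q hQ hQP => ?_⟩
    have hv := vanish_mem_aux x₀ P hPproper Q hQ hQP hP
    have hQe : Q = {f : C(X, A) | f x₀ ∈ {a : A | ContinuousMap.const X a ∈ Q}} := by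
      ext f
      have hd : f - ContinuousMap.const X (f x₀) ∈ Q := hv _ (by simp)
      constructor
      · intro hf
        have := hQ.1.add_mem _ _ hf (hQ.1.neg_mem _ hd)
        have e : f + -(f - ContinuousMap.const X (f x₀)) = ContinuousMap.const X (f x₀) := by abel
        rw [e] at this
        exact this
      · intro hf
        have := hQ.1.add_mem _ _ hd hf
        rwa [sub_add_cancel] at this
    have hp : IsPrimalR {a : A | ContinuousMap.const X a ∈ Q} :=
      primal_of_eval_aux x₀ _ (closed_const_aux Q hQ.1) (hQe ▸ hQ)
    have h3 := h2 _ hp (fun a ha => hQP ha)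
    rw [h3] at hQe
    exact hQe
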